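/- arXiv:cs/0607071 — 2 statements merged into one kernel-verified Lean document; each statement's English description precedes it below -/
import Mathlib

section
/- Let < be a linear order on the variables and C a finite set of nonempty standard-form clauses that is <-primal non-conflicting. Then C is compositional: every subset C' ⊆ C is also an island. -/
/-- A state assigns a Boolean value to every variable. -/
abbrev State (V : Type*) := V → Bool

/-- A state satisfies a clause (a finite set of literals) if at least one
of its literals is true in the state. -/
def Sat {V : Type*} (s : State V) (c : Finset (V × Bool)) : Prop :=
  ∃ l ∈ c, s l.1 = l.2

/-- A clause is in standard form if no variable occurs in it with both polarities. -/
def StdForm {V : Type*} (c : Finset (V × Bool)) : Prop :=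
  ¬ ∃ x : V, (x, true) ∈ c ∧ (x, false) ∈ c

/-- `l` is the `<`-primal literal of clause `c`: it belongs to `c` and its variable is
least (w.r.t. the order) among the variables occurring in `c`. -/
def PrimalLit {V : Type*} [LinearOrder V] (c : Finset (V × Bool)) (l : V × Bool) : Prop :=
  l ∈ c ∧ ∀ l' ∈ c, l.1 ≤ l'.1

/-- The `<`-primal literal set of a set of clauses. -/
def PLit {V : Type*} [LinearOrder V] (C : Set (Finset (V × Bool))) : Set (V × Bool) :=
  {l | ∃ c ∈ C, PrimalLit c l}

/-- `C` is `<`-primal non-conflicting if no variable occurs with both polarities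
in the `<`-primal literal set of `C`. -/
def PrimalNonConflicting {V : Type*} [LinearOrder V] (C : Set (Finset (V × Bool))) : Prop :=
  ¬ ∃ x : V, (x, true) ∈ PLit C ∧ (x, false) ∈ PLit C

/-- Two states are neighbours if they differ in the value of exactly one variable. -/
def Neighbour {V : Type*} (s s' : State V) : Prop :=
  ∃! x : V, s x ≠ s' x

/-- A set `C` of clauses is an island if any two states satisfying every clause of `C`
are connected by a finite sequence of states, each satisfying every clause of `C`,
in which consecutive states are neighbours. -/
def IsIsland {V : Type*} (C : Set (Finset (V × Bool))) : Prop :=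
  ∀ s₀ sN : State V, (∀ c ∈ C, Sat s₀ c) → (∀ c ∈ C, Sat sN c) →
    ∃ (n : ℕ) (p : Fin (n + 1) → State V),
      p 0 = s₀ ∧ p (Fin.last n) = sN ∧
      (∀ i, ∀ c ∈ C, Sat (p i) c) ∧
      ∀ i : Fin n, Neighbour (p i.castSucc) (p i.succ)

/-- The relation of being neighbouring states that both satisfy every clause of `C`. -/
def SatStep {V : Type*} (C : Set (Finset (V × Bool))) (s t : State V) : Prop :=
  (∀ c ∈ C, Sat s c) ∧ (∀ c ∈ C, Sat t c) ∧ Neighbour s t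

theorem Neighbour.symm {V : Type*} {s t : State V} (h : Neighbour s t) : Neighbour t s := by
  simpa only [Neighbour, ne_comm] using h

theorem SatStep.symm {V : Type*} {C : Set (Finset (V × Bool))} {s t : State V}
    (h : SatStep C s t) : SatStep C t s :=
  ⟨h.2.1, h.1, h.2.2.symm⟩

/-- Reachability by `SatStep` yields an explicit finite sequence of states. -/
theorem exists_path_of_reflTransGen_satStep {V : Type*} {C : Set (Finset (V × Bool))}
    {s t : State V} (ht : ∀ c ∈ C, Sat t c) (h : Relation.ReflTransGen (SatStep C) s t) :
    ∃ (n : ℕ) (p : Fin (n + 1) → State V),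
      p 0 = s ∧ p (Fin.last n) = t ∧
      (∀ i, ∀ c ∈ C, Sat (p i) c) ∧
      ∀ i : Fin n, Neighbour (p i.castSucc) (p i.succ) := by
  induction h using Relation.ReflTransGen.head_induction_on with
  | refl => exact ⟨0, fun _ => t, rfl, rfl, fun _ => ht, fun i => i.elim0⟩
  | @head a b hab _ ih =>
    obtain ⟨n, p, h0, hl, hs, hn⟩ := ih
    refine ⟨n + 1, Fin.cons a p, rfl, ?_, ?_, ?_⟩
    · rw [← Fin.succ_last, Fin.cons_succ, hl]
    · intro i
      cases i using Fin.cases with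
      | zero => exact hab.1
      | succ i => exact hs i
    · intro i
      cases i using Fin.cases with
      | zero => simpa [h0] using hab.2.2
      | succ i => simpa [← Fin.succ_castSucc] using hn i

theorem exists_primalLit {V : Type*} [LinearOrder V] {c : Finset (V × Bool)}
    (hc : c.Nonempty) : ∃ l, PrimalLit c l :=
  c.exists_min_image Prod.fst hc

theorem PLit_mono {V : Type*} [LinearOrder V] {C D : Set (Finset (V × Bool))} (h : C ⊆ D) :
    PLit C ⊆ PLit D :=
  fun _ ⟨c, hc, hl⟩ => ⟨c, h hc, hl⟩

/-- A primal non-conflicting set of clauses has a state in which all its primal literals hold. -/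
theorem PrimalNonConflicting.exists_state {V : Type*} [LinearOrder V]
    {C : Set (Finset (V × Bool))} (h : PrimalNonConflicting C) :
    ∃ g : State V, ∀ l ∈ PLit C, g l.1 = l.2 := by
  classical
  refine ⟨fun x => decide ((x, true) ∈ PLit C), ?_⟩
  rintro ⟨x, _ | _⟩ hl
  · exact decide_eq_false fun ht => h ⟨x, ht, hl⟩
  · exact decide_eq_true hl

/-- If all primal literals of `C` hold in `g`, then overwriting a satisfying state by `g` on a
lower set of variables keeps it satisfying. -/
theorem sat_piecewise_of_isLowerSet {V : Type*} [LinearOrder V]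
    {C : Set (Finset (V × Bool))} (hne : ∀ c ∈ C, c.Nonempty) {g s : State V}
    (hg : ∀ l ∈ PLit C, g l.1 = l.2) (hs : ∀ c ∈ C, Sat s c) {A : Finset V}
    (hA : IsLowerSet (A : Set V)) : ∀ c ∈ C, Sat (A.piecewise g s) c := by
  intro c hc
  obtain ⟨l, hl⟩ := exists_primalLit (hne c hc)
  by_cases hlA : l.1 ∈ A
  · exact ⟨l, hl.1, by rw [Finset.piecewise_eq_of_mem _ _ _ hlA, hg l ⟨c, hc, hl⟩]⟩
  · obtain ⟨m, hm, hsm⟩ := hs c hc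
    have hmA : m.1 ∉ A := fun h => hlA (hA (hl.2 m hm) h)
    exact ⟨m, hm, by rw [Finset.piecewise_eq_of_notMem _ _ _ hmA, hsm]⟩

/-- If all primal literals of `C` hold in `g`, then overwriting a satisfying state by `g` on a
lower set of variables can be done one variable at a time, in increasing order. -/
theorem reflTransGen_satStep_piecewise {V : Type*} [LinearOrder V]
    {C : Set (Finset (V × Bool))} (hne : ∀ c ∈ C, c.Nonempty) {g s : State V}
    (hg : ∀ l ∈ PLit C, g l.1 = l.2) (hs : ∀ c ∈ C, Sat s c) (A : Finset V)
    (hA : IsLowerSet (A : Set V)) :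
    Relation.ReflTransGen (SatStep C) s (A.piecewise g s) := by
  induction A using Finset.induction_on_max with
  | empty => simpa using Relation.ReflTransGen.refl
  | insert a A ha ih =>
    have hA' : IsLowerSet (A : Set V) := by
      intro x y hyx hx
      have hy : y ∈ insert a A := hA hyx (by simpa using Or.inr hx)
      exact (Finset.mem_insert.1 hy).resolve_left (hyx.trans_lt (ha x hx)).ne
    have haA : a ∉ A := fun h => (ha a h).false
    by_cases hga : g a = s a
    · convert ih hA' using 1
      rw [Finset.piecewise_insert, hga]
      simp [haA]
    · refine (ih hA').tail ⟨sat_piecewise_of_isLowerSet hne hg hs hA',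
        sat_piecewise_of_isLowerSet hne hg hs hA, a, ?_, ?_⟩
      · simpa [haA] using Ne.symm hga
      · intro y hy
        by_contra hya
        exact hy (by simp [hya])

/-- A `<`-primal non-conflicting finite set of nonempty standard-form clauses
is compositional: every subset of it is an island. -/
theorem primalNonConflicting_compositional {V : Type*} [LinearOrder V] [Fintype V]
    (C : Finset (Finset (V × Bool)))
    (hne : ∀ c ∈ C, Finset.Nonempty c) (hstd : ∀ c ∈ C, StdForm c)
    (hpnc : PrimalNonConflicting (↑C : Set (Finset (V × Bool)))) :
    ∀ C' ⊆ C, IsIsland (↑C' : Set (Finset (V × Bool))) := by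
  intro C' hC' s t hs ht
  have hne' : ∀ c ∈ (C' : Set (Finset (V × Bool))), c.Nonempty := fun c hc => hne c (hC' hc)
  obtain ⟨g, hg⟩ := hpnc.exists_state
  have hg' : ∀ l ∈ PLit (C' : Set (Finset (V × Bool))), g l.1 = l.2 :=
    fun l hl => hg l (PLit_mono (by exact_mod_cast hC') hl)
  have key : ∀ u : State V, (∀ c ∈ (C' : Set (Finset (V × Bool))), Sat u c) →
      Relation.ReflTransGen (SatStep (C' : Set (Finset (V × Bool)))) u g := fun u hu => by
    simpa using reflTransGen_satStep_piecewise hne' hg' hu Finset.univ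
      (by simpa using isLowerSet_univ)
  have hsymm : Std.Symm (SatStep (C' : Set (Finset (V × Bool)))) := ⟨fun _ _ h => h.symm⟩
  exact exists_path_of_reflTransGen_satStep ht
    ((key s hs).trans (Relation.ReflTransGen.stdSymm.symm _ _ (key t ht)))
end

section
/- Let < be a linear order on the variables and C a finite set of nonempty standard-form clauses that is <-primal non-conflicting. Then every state s satisfying all clauses of C is connected within the solution space of C to a state ŝ in which every literal of pLit_<(C) is true: there is a finite sequence of states from s to ŝ, each satisfying all clauses of C, in which consecutive states differ in the value of exactly one variable. -/
theorem PrimalNonConflicting.eq_of_mem {V : Type*} [LinearOrder V]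
    {C : Set (Finset (V × Bool))} (hC : PrimalNonConflicting C) {x : V} {a b : Bool}
    (ha : (x, a) ∈ PLit C) (hb : (x, b) ∈ PLit C) : a = b := by
  by_contra hab
  cases a <;> cases b <;> simp_all [PrimalNonConflicting]

theorem neighbour_update {V : Type*} [DecidableEq V] (s : State V) {x : V} {b : Bool}
    (h : s x ≠ b) : Neighbour s (Function.update s x b) := by
  refine ⟨x, by simpa using h, fun y hy => ?_⟩
  by_contra hyx
  simp [Function.update_of_ne hyx] at hy

/-- Making a primal literal true preserves satisfaction of a clause, provided the primal literals
with smaller variables are already true. -/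
theorem Sat.update_of_mem_pLit {V : Type*} [LinearOrder V]
    {C : Set (Finset (V × Bool))} (hC : PrimalNonConflicting C) {s : State V} {l : V × Bool}
    (hl : l ∈ PLit C) (hlt : ∀ l' ∈ PLit C, l'.1 < l.1 → s l'.1 = l'.2)
    {c : Finset (V × Bool)} (hc : c ∈ C) (hs : Sat s c) :
    Sat (Function.update s l.1 l.2) c := by
  obtain ⟨m, hm, hsm⟩ := hs
  by_cases hml : m.1 = l.1
  · obtain ⟨k, hk⟩ := exists_primalLit ⟨m, hm⟩
    have hkC : k ∈ PLit C := ⟨c, hc, hk⟩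
    refine ⟨k, hk.1, ?_⟩
    rcases (hml ▸ hk.2 m hm : k.1 ≤ l.1).eq_or_lt with hkl | hkl
    · obtain ⟨x, a⟩ := k
      obtain rfl : x = l.1 := hkl
      simpa using hC.eq_of_mem hl hkC
    · rw [Function.update_of_ne hkl.ne]
      exact hlt k hkC hkl
  · exact ⟨m, hm, by rwa [Function.update_of_ne hml]⟩

theorem finite_pLit {V : Type*} [LinearOrder V] (C : Finset (Finset (V × Bool))) :
    (PLit (↑C : Set (Finset (V × Bool)))).Finite := by
  refine (C.finite_toSet.biUnion fun c _ => c.finite_toSet).subset ?_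
  rintro l ⟨c, hc, hl⟩
  exact Set.mem_biUnion hc hl.1

/-- Let `C` be a `<`-primal non-conflicting finite set of nonempty standard-form
clauses.  Every state `s` satisfying all clauses of `C` is connected, within the
solution space of `C`, to a state `ŝ` making every literal of the `<`-primal
literal set of `C` true. -/
theorem solution_connected_to_pLit_state {V : Type*} [LinearOrder V]
    (C : Finset (Finset (V × Bool)))
    (hne : ∀ c ∈ C, Finset.Nonempty c) (hstd : ∀ c ∈ C, StdForm c)
    (hpnc : PrimalNonConflicting (↑C : Set (Finset (V × Bool))))
    (s : State V) (hs : ∀ c ∈ C, Sat s c) :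
    ∃ (sHat : State V), (∀ l ∈ PLit (↑C : Set (Finset (V × Bool))), sHat l.1 = l.2) ∧
      ∃ (n : ℕ) (p : Fin (n + 1) → State V),
        p 0 = s ∧ p (Fin.last n) = sHat ∧
        (∀ i, ∀ c ∈ C, Sat (p i) c) ∧
        ∀ i : Fin n, Neighbour (p i.castSucc) (p i.succ) := by
  clear hne hstd
  induction hk : {l ∈ PLit (↑C : Set (Finset (V × Bool))) | s l.1 ≠ l.2}.ncard
    using Nat.strong_induction_on generalizing s with
  | _ k ih =>
  have hfin : {l ∈ PLit (↑C : Set (Finset (V × Bool))) | s l.1 ≠ l.2}.Finite :=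
    (finite_pLit C).subset (Set.sep_subset _ _)
  rcases Set.eq_empty_or_nonempty {l ∈ PLit (↑C : Set (Finset (V × Bool))) | s l.1 ≠ l.2}
    with hF | hF
  · refine ⟨s, fun l hl => ?_, 0, fun _ => s, rfl, rfl, fun _ => hs, fun i => i.elim0⟩
    by_contra h
    exact Set.eq_empty_iff_forall_notMem.mp hF l ⟨hl, h⟩
  · obtain ⟨l, ⟨hl, hsl⟩, hmin⟩ := Set.exists_min_image _ Prod.fst hfin hF
    have hlt : ∀ l' ∈ PLit (↑C : Set (Finset (V × Bool))), l'.1 < l.1 → s l'.1 = l'.2 := by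
      intro l' hl' h
      by_contra h'
      exact (hmin l' ⟨hl', h'⟩).not_gt h
    have hcard : {m ∈ PLit (↑C : Set (Finset (V × Bool))) |
        Function.update s l.1 l.2 m.1 ≠ m.2}.ncard < k := by
      rw [← hk]
      refine Set.ncard_lt_ncard ((Set.ssubset_iff_of_subset ?_).mpr
        ⟨l, ⟨hl, hsl⟩, fun h => h.2 (by simp)⟩) hfin
      rintro ⟨x, a⟩ ⟨hm, h⟩
      by_cases hx : x = l.1
      · subst hx
        exact absurd (by simpa using hpnc.eq_of_mem hl hm) h
      · exact ⟨hm, by simpa [Function.update_of_ne hx] using h⟩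
    obtain ⟨sHat, hsHat, n, p, hp0, hpn, hpC, hpN⟩ := ih _ hcard (Function.update s l.1 l.2)
      (fun c hc => (hs c hc).update_of_mem_pLit hpnc hl hlt (Finset.mem_coe.mpr hc)) rfl
    refine ⟨sHat, hsHat, n + 1, Fin.cons s p, rfl, ?_, ?_, ?_⟩
    · rw [← Fin.succ_last, Fin.cons_succ, hpn]
    · exact Fin.cases hs hpC
    · refine Fin.cases ?_ fun i => ?_
      · simpa [hp0] using neighbour_update s hsl
      · rw [← Fin.succ_castSucc, Fin.cons_succ, Fin.cons_succ]
        exact hpN i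
end
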